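/- arXiv:1306.1480 — 5 statements merged into one kernel-verified Lean document; each statement's English description precedes it below -/
import Mathlib

section
/- Let p be a prime, α ≥ 1, N ≥ 1, and let 0 ≤ k ≤ N. If G is a subgroup of (ℤ/p^αℤ)^N which contains no subgroup isomorphic to (ℤ/p^αℤ)^{k+1}, then |G| ≤ p^{αk}·p^{(α−1)(N−k)}. -/
/-- If multiplication by `p ^ a` on a finite abelian group `A` of exponent dividing `p ^ (a + 1)`
has image of order greater than `p ^ k`, then `A` contains a copy of
`(ℤ / p ^ (a + 1) ℤ) ^ (k + 1)`. -/
theorem exists_injective_homocyclic_of_lt_card_range_nsmul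
    (p : ℕ) [Fact p.Prime] (a k : ℕ) {A : Type*} [AddCommGroup A] [Finite A]
    (hA : ∀ x : A, p ^ (a + 1) • x = 0)
    (hcard : p ^ k < Nat.card (nsmulAddMonoidHom (α := A) (p ^ a)).range) :
    ∃ f : (Fin (k + 1) → ZMod (p ^ (a + 1))) →+ A, Function.Injective f := by
  have hp : p.Prime := Fact.out
  let K := (nsmulAddMonoidHom (α := A) (p ^ a)).range
  have hK : ∀ x : K, p • x = 0 := by
    rintro ⟨_, x, rfl⟩
    ext
    simpa [← mul_smul, ← pow_succ'] using hA x
  let : Module (ZMod p) K := AddCommGroup.zmodModule hK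
  let : Module (ZMod (p ^ (a + 1))) A := AddCommGroup.zmodModule hA
  have hrank : k + 1 ≤ Module.finrank (ZMod p) K := by
    have h := FiniteField.pow_finrank_eq_natCard p K
    exact (Nat.pow_lt_pow_iff_right hp.one_lt).1 (h ▸ hcard)
  obtain ⟨v, hv⟩ := exists_linearIndependent_of_le_finrank hrank
  choose g hg using fun i => (v i).2
  replace hg : ∀ i, p ^ a • g i = v i := hg
  have hdvd : ∀ d : Fin (k + 1) → ZMod (p ^ (a + 1)),
      p ^ a • ∑ i, d i • g i = 0 → ∀ i, ∃ e, d i = p * e := by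
    intro d hd i
    have hsum : ∑ i, ((d i).val : ZMod p) • v i = 0 := by
      ext
      rw [AddSubgroup.coe_zero, ← hd, Finset.smul_sum]
      simp only [Nat.cast_smul_eq_nsmul, AddSubgroup.val_finsetSum, AddSubgroup.coe_nsmul]
      refine Finset.sum_congr rfl fun j _ => ?_
      rw [← hg, smul_comm, ← Nat.cast_smul_eq_nsmul (ZMod (p ^ (a + 1))) (d j).val,
        ZMod.natCast_zmod_val, smul_comm]
    obtain ⟨e, he⟩ := (ZMod.natCast_eq_zero_iff _ _).1
      (Fintype.linearIndependent_iff.1 hv _ hsum i)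
    refine ⟨e, ?_⟩
    rw [← ZMod.natCast_zmod_val (d i), he, Nat.cast_mul]
  refine ⟨(Fintype.linearCombination (ZMod (p ^ (a + 1))) g).toAddMonoidHom,
    (injective_iff_map_eq_zero _).2 fun c hc => ?_⟩
  replace hc : ∑ i, c i • g i = 0 := hc
  have key : ∀ j ≤ a + 1, ∃ d : Fin (k + 1) → ZMod (p ^ (a + 1)),
      ∀ i, c i = ((p ^ j : ℕ) : ZMod (p ^ (a + 1))) * d i := by
    intro j
    induction j with
    | zero => exact fun _ => ⟨c, by simp⟩
    | succ j ih =>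
      intro hj
      obtain ⟨d, hd⟩ := ih (by omega)
      have h0 : p ^ a • ∑ i, d i • g i = 0 := by
        have h1 : p ^ j • ∑ i, d i • g i = 0 := by
          rw [← hc, Finset.smul_sum]
          refine Finset.sum_congr rfl fun i _ => ?_
          rw [hd i, mul_smul, Nat.cast_smul_eq_nsmul]
        rw [← pow_sub_mul_pow p (show j ≤ a by omega), mul_smul, h1, smul_zero]
      choose e he using hdvd d h0
      refine ⟨e, fun i => ?_⟩
      rw [hd, he]
      push_cast
      ring
  obtain ⟨d, hd⟩ := key (a + 1) le_rfl
  ext i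
  rw [hd, ZMod.natCast_self, zero_mul, Pi.zero_apply]

/-- At most `n ^ N` elements of `(ℤ / m ℤ) ^ N` are annihilated by `n`. -/
theorem card_ker_nsmul_pi_zmod_le (m n N : ℕ) [NeZero m] (hn : 0 < n) :
    Nat.card {x : Fin N → ZMod m // n • x = 0} ≤ n ^ N := by
  let f : {x : Fin N → ZMod m // n • x = 0} → Fin N → {y : ZMod m // n • y = 0} :=
    fun x i => ⟨x.1 i, congrFun x.2 i⟩
  have hf : Function.Injective f := fun x y h =>
    Subtype.ext (funext fun i => congrArg Subtype.val (congrFun h i))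
  refine (Nat.card_le_card_of_injective f hf).trans ?_
  rw [Nat.card_fun, Nat.card_fin]
  refine Nat.pow_le_pow_left ?_ N
  rw [Nat.card_eq_fintype_card, Fintype.card_subtype]
  exact IsAddCyclic.card_nsmul_eq_zero_le hn

/-- Lemma 3. Let `p` be a prime, `α ≥ 1`, `N ≥ 1`, `0 ≤ k ≤ N`.
If `G` is a subgroup of `(ℤ/p^αℤ)^N` containing no subgroup isomorphic to
`(ℤ/p^αℤ)^{k+1}`, then `|G| ≤ p^{αk}·p^{(α−1)(N−k)}`. -/
theorem card_subgroup_avoiding_homocyclic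
    (p : ℕ) [Fact p.Prime] (α N k : ℕ) (hα : 1 ≤ α) (hN : 1 ≤ N) (hk : k ≤ N)
    (G : AddSubgroup (Fin N → ZMod (p ^ α)))
    (hG : ∀ H : AddSubgroup (Fin N → ZMod (p ^ α)), H ≤ G →
      ¬ Nonempty (H ≃+ (Fin (k + 1) → ZMod (p ^ α)))) :
    Nat.card G ≤ p ^ (α * k) * p ^ ((α - 1) * (N - k)) := by
  obtain ⟨a, rfl⟩ := Nat.exists_eq_add_of_le' hα
  have hp : p.Prime := Fact.out
  have : NeZero (p ^ (a + 1)) := ⟨(pow_pos hp.pos _).ne'⟩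
  let φ := nsmulAddMonoidHom (α := G) (p ^ a)
  have hrange : Nat.card φ.range ≤ p ^ k := by
    by_contra! hlt
    obtain ⟨f, hf⟩ := exists_injective_homocyclic_of_lt_card_range_nsmul p a k
      (fun x : G => by
        ext i
        simp [nsmul_eq_mul, -Nat.cast_pow]) hlt
    refine hG (G.subtype.comp f).range ?_
      ⟨(AddMonoidHom.ofInjective (f := G.subtype.comp f) (G.subtype_injective.comp hf)).symm⟩
    rintro _ ⟨x, rfl⟩
    exact (f x).2
  have hker : Nat.card φ.ker ≤ (p ^ a) ^ N := by
    let ι : φ.ker → {x : Fin N → ZMod (p ^ (a + 1)) // p ^ a • x = 0} :=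
      fun x => ⟨x.1.1, congrArg Subtype.val x.2⟩
    have hι : Function.Injective ι := fun x y h =>
      Subtype.ext (Subtype.ext (Subtype.mk.inj h))
    exact (Nat.card_le_card_of_injective ι hι).trans
      (card_ker_nsmul_pi_zmod_le _ _ N (pow_pos hp.pos a))
  calc Nat.card G = Nat.card φ.ker * Nat.card φ.range := by
        rw [← AddSubgroup.index_ker, AddSubgroup.card_mul_index]
    _ ≤ (p ^ a) ^ N * p ^ k := Nat.mul_le_mul hker hrange
    _ = p ^ ((a + 1) * k) * p ^ ((a + 1 - 1) * (N - k)) := by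
        obtain ⟨m, rfl⟩ := Nat.exists_eq_add_of_le hk
        rw [← pow_mul, ← pow_add, ← pow_add, Nat.add_sub_cancel, Nat.add_sub_cancel_left]
        ring_nf
end

section
/- Let p be a prime and α, N ≥ 1. For every r ≥ 1, the number of subgroups of (ℤ/p^αℤ)^N of order p^r is at most 2^{r−1}·p^{Nr + r²}. -/
/-- An additive group of order `p ^ (r + 1)` has a subgroup of order `p ^ r`. -/
theorem AddSubgroup.exists_card_pow_of_card_pow_succ {G : Type*} [AddCommGroup G] [Finite G]
    {p r : ℕ} [Fact p.Prime] (hG : Nat.card G = p ^ (r + 1)) :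
    ∃ K : AddSubgroup G, Nat.card K = p ^ r := by
  obtain ⟨K, hK⟩ := Sylow.exists_subgroup_card_pow_prime (G := Multiplicative G) p (n := r)
    (hG ▸ pow_dvd_pow p r.le_succ)
  exact ⟨Subgroup.toAddSubgroup' K, hK⟩

/-- A subgroup of order `p ^ (r + 1)` is generated by a subgroup of order `p ^ r` together with
one element whose multiple by `p` lies in that subgroup. -/
theorem AddSubgroup.exists_eq_sup_zmultiples {G : Type*} [AddCommGroup G] [Finite G]
    {p r : ℕ} [hp : Fact p.Prime] {H : AddSubgroup G} (hH : Nat.card H = p ^ (r + 1)) :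
    ∃ K : AddSubgroup G, Nat.card K = p ^ r ∧
      ∃ x, p • x ∈ K ∧ K ⊔ AddSubgroup.zmultiples x = H := by
  obtain ⟨K, hK⟩ := AddSubgroup.exists_card_pow_of_card_pow_succ hH
  have hindex : K.index = p := by
    have h := K.card_mul_index
    rw [hK, hH, pow_succ] at h
    exact Nat.eq_of_mul_eq_mul_left (pow_pos hp.out.pos r) h
  have hne : ∃ x : H, x ∉ K := by
    by_contra! h
    rw [(AddSubgroup.eq_top_iff' K).2 h, AddSubgroup.index_top] at hindex
    exact hp.out.one_lt.ne hindex
  obtain ⟨x, hx⟩ := hne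
  have hsup : K ⊔ AddSubgroup.zmultiples x = ⊤ := by
    set L := K ⊔ AddSubgroup.zmultiples x
    have hdvd : L.index ∣ p := hindex ▸ AddSubgroup.index_dvd_of_le (le_sup_left : K ≤ L)
    rcases (Nat.dvd_prime hp.out).1 hdvd with h | h
    · exact AddSubgroup.index_eq_one.1 h
    · exfalso
      have hKL : K = L := by
        refine AddSubgroup.eq_of_le_of_card_ge le_sup_left ?_
        refine (Nat.eq_of_mul_eq_mul_right hp.out.pos ?_).le
        rw [← h, L.card_mul_index, h, ← hindex, K.card_mul_index]
      exact hx (hKL ▸ (le_sup_right : _ ≤ L) (AddSubgroup.mem_zmultiples x))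
  refine ⟨K.map H.subtype, ?_, x, ?_, ?_⟩
  · rw [AddSubgroup.card_map_of_injective H.subtype_injective, hK]
  · exact ⟨p • x, hindex ▸ AddSubgroup.nsmul_index_mem K x, rfl⟩
  · have h := congrArg (AddSubgroup.map H.subtype) hsup
    rwa [AddSubgroup.map_sup, AddMonoidHom.map_zmultiples, ← AddMonoidHom.range_eq_map,
      AddSubgroup.range_subtype] at h

/-- The preimage of a finite subgroup has at most as many elements as the subgroup times the
kernel. -/
theorem AddSubgroup.card_comap_le {G G' : Type*} [AddGroup G] [AddGroup G'] [Finite G]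
    (f : G →+ G') (K : AddSubgroup G') [Finite K] :
    Nat.card (K.comap f) ≤ Nat.card K * Nat.card f.ker := by
  have h := (f.addSubgroupComap K).ker.card_mul_index
  rw [AddSubgroup.index_ker, mul_comm] at h
  rw [← h]
  refine Nat.mul_le_mul (AddSubgroup.card_le_card_addGroup _) ?_
  refine Nat.card_le_card_of_injective
    (fun y => (⟨y.1.1, congrArg Subtype.val y.2⟩ : f.ker)) ?_
  intro y z hyz
  have h : y.1.1 = z.1.1 := Subtype.mk.inj hyz
  exact Subtype.ext (Subtype.ext h)

/-- Multiplying the order of the subgroups by `p` multiplies their number by at most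
`p ^ r` times the size of the `p`-torsion. -/
theorem AddSubgroup.ncard_card_pow_succ_le {G : Type*} [AddCommGroup G] [Finite G]
    (p r : ℕ) [Fact p.Prime] :
    {H : AddSubgroup G | Nat.card H = p ^ (r + 1)}.ncard ≤
      {H : AddSubgroup G | Nat.card H = p ^ r}.ncard *
        (p ^ r * Nat.card (nsmulAddMonoidHom (α := G) p).ker) := by
  classical
  have := Fintype.ofFinite (AddSubgroup G)
  have := Fintype.ofFinite G
  rw [Set.ncard_eq_toFinset_card', Set.ncard_eq_toFinset_card']
  set f := nsmulAddMonoidHom (α := G) p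
  let F : AddSubgroup G → Finset (AddSubgroup G) := fun K =>
    (Set.toFinset (K.comap f : Set G)).image fun x => K ⊔ AddSubgroup.zmultiples x
  have hsub : {H : AddSubgroup G | Nat.card H = p ^ (r + 1)}.toFinset ⊆
      {H : AddSubgroup G | Nat.card H = p ^ r}.toFinset.biUnion F := by
    intro H hH
    rw [Set.mem_toFinset, Set.mem_ofPred_eq] at hH
    obtain ⟨K, hK, x, hx, hsup⟩ := AddSubgroup.exists_eq_sup_zmultiples hH
    exact Finset.mem_biUnion.2 ⟨K, Set.mem_toFinset.2 hK,
      Finset.mem_image.2 ⟨x, Set.mem_toFinset.2 hx, hsup⟩⟩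
  refine (Finset.card_le_card hsub).trans (Finset.card_biUnion_le_card_mul _ _ _ ?_)
  intro K hK
  refine Finset.card_image_le.trans ?_
  rw [← Set.ncard_eq_toFinset_card', ← Set.mem_toFinset.1 hK]
  exact AddSubgroup.card_comap_le f K

/-- If the `p`-torsion has order at most `p ^ N`, there are at most `p ^ (N * r + r ^ 2)` subgroups
of order `p ^ r`. -/
theorem AddSubgroup.ncard_card_pow_le {G : Type*} [AddCommGroup G] [Finite G]
    {p N : ℕ} [hp : Fact p.Prime] (hG : Nat.card (nsmulAddMonoidHom (α := G) p).ker ≤ p ^ N)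
    (r : ℕ) :
    {H : AddSubgroup G | Nat.card H = p ^ r}.ncard ≤ p ^ (N * r + r ^ 2) := by
  induction r with
  | zero => simp [AddSubgroup.card_eq_one]
  | succ r ih =>
    calc _ ≤ p ^ (N * r + r ^ 2) * (p ^ r * p ^ N) :=
          (AddSubgroup.ncard_card_pow_succ_le p r).trans
            (Nat.mul_le_mul ih (Nat.mul_le_mul_left _ hG))
      _ = p ^ (N * r + r ^ 2 + (r + N)) := by ring
      _ ≤ _ := Nat.pow_le_pow_right hp.out.pos (by nlinarith)

/-- The `n`-torsion of a finite power of a finite cyclic group has order at most `n` to that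
power. -/
theorem IsAddCyclic.card_ker_nsmul_pi_le {ι C : Type*} [Fintype ι] [AddCommGroup C] [Finite C]
    [IsAddCyclic C] {n : ℕ} (hn : 0 < n) :
    Nat.card (nsmulAddMonoidHom (α := ι → C) n).ker ≤ n ^ Fintype.card ι := by
  classical
  have := Fintype.ofFinite C
  calc Nat.card (nsmulAddMonoidHom (α := ι → C) n).ker
      ≤ Nat.card (ι → {c : C // n • c = 0}) :=
        Nat.card_le_card_of_injective (fun x i => ⟨x.1 i, congrFun x.2 i⟩) fun x y h =>
          Subtype.ext (funext fun i => congrArg Subtype.val (congrFun h i))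
    _ = Nat.card {c : C // n • c = 0} ^ Fintype.card ι := by
        rw [Nat.card_fun, Nat.card_eq_fintype_card (α := ι)]
    _ ≤ n ^ Fintype.card ι := by
        refine Nat.pow_le_pow_left ?_ _
        rw [Nat.card_eq_fintype_card, Fintype.card_subtype]
        exact IsAddCyclic.card_nsmul_eq_zero_le hn

/-- upper bound from the Appendix. Let `p` be a prime and
`α, N, r ≥ 1`. The number of subgroups of `(ℤ/p^αℤ)^N` of order `p^r` is at most
`2^{r−1}·p^{Nr + r²}`. -/
theorem count_subgroups_homocyclic_upper
    (p : ℕ) [Fact p.Prime] (α N r : ℕ) (hα : 1 ≤ α) (hN : 1 ≤ N) (hr : 1 ≤ r) :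
    {H : AddSubgroup (Fin N → ZMod (p ^ α)) | Nat.card H = p ^ r}.ncard ≤
      2 ^ (r - 1) * p ^ (N * r + r ^ 2) := by
  have hp := (Fact.out : p.Prime).pos
  have : NeZero (p ^ α) := ⟨(pow_pos hp α).ne'⟩
  have htorsion := IsAddCyclic.card_ker_nsmul_pi_le (ι := Fin N) (C := ZMod (p ^ α)) hp
  rw [Fintype.card_fin] at htorsion
  exact (AddSubgroup.ncard_card_pow_le htorsion r).trans
    (Nat.le_mul_of_pos_left _ (pow_pos two_pos _))
end

section
/- Let p be a prime, α ≥ 2 and N ≥ 1. Let A be a finite abelian p-group of order p^{Nα} whose exponent divides p^{α−1}. Then for every r with 1 ≤ r ≤ N, the number of subgroups of A of order p^r is at least p^{(α/(α−1))·Nr − 2r²}. -/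
/-- In a finite vector space of dimension `n` over a field with `q` elements, the number of
`r`-dimensional subspaces is at least `q ^ (r * n) / q ^ (r * r + r)`. -/
theorem pow_le_ncard_submodule_finrank_eq_mul {K V : Type*} [Field K] [Finite K] [AddCommGroup V]
    [Module K V] [Finite V] {r : ℕ} (hr : r ≤ Module.finrank K V) :
    Nat.card K ^ (r * Module.finrank K V) ≤
      {W : Submodule K V | Module.finrank K W = r}.ncard * Nat.card K ^ (r * r + r) := by
  have := Fintype.ofFinite K
  set n := Module.finrank K V
  set q := Nat.card K
  have hq : 2 ≤ q := Finite.one_lt_card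
  have hindep : q ^ (r * n) ≤ Nat.card {s : Fin r → V // LinearIndependent K s} * q ^ r := by
    rw [card_linearIndependent hr, Fintype.card_eq_nat_card]
    calc q ^ (r * n) = ∏ _i : Fin r, q ^ n := by
          rw [Finset.prod_const, Finset.card_univ, Fintype.card_fin, ← pow_mul, mul_comm]
      _ ≤ ∏ i : Fin r, ((q ^ n - q ^ (i : ℕ)) * q) := by
          refine Finset.prod_le_prod' fun i _ => ?_
          have hle : q ^ (i : ℕ) * q ≤ q ^ n := by
            rw [← pow_succ]
            exact Nat.pow_le_pow_right (by lia) (by lia)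
          have hn : q ^ n * 2 ≤ q ^ n * q := Nat.mul_le_mul_left _ hq
          rw [Nat.sub_mul]
          lia
      _ = _ := by
          rw [Finset.prod_mul_distrib, Finset.prod_const, Finset.card_univ, Fintype.card_fin]
  have hspan : Nat.card {s : Fin r → V // LinearIndependent K s} ≤
      {W : Submodule K V | Module.finrank K W = r}.ncard * q ^ (r * r) := by
    let S := {W : Submodule K V | Module.finrank K W = r}
    let φ : {s : Fin r → V // LinearIndependent K s} → Σ W : S, (Fin r → W.1) := fun s =>
      ⟨⟨Submodule.span K (Set.range s.1), by
        simpa [S] using finrank_span_eq_card s.2⟩,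
        fun i => ⟨s.1 i, Submodule.subset_span ⟨i, rfl⟩⟩⟩
    have hφ : Function.Injective φ := fun s t hst => Subtype.ext <|
      congrArg (fun x : Σ W : S, (Fin r → W.1) => fun i => ((x.2 i : x.1.1) : V)) hst
    have := Fintype.ofFinite S
    have hW (W : S) : Nat.card (Fin r → W.1) = q ^ (r * r) := by
      have hWr : Module.finrank K W.1 = r := W.2
      rw [Nat.card_fun, Nat.card_fin, Module.natCard_eq_pow_finrank (K := K), hWr, ← pow_mul]
    refine (Nat.card_le_card_of_injective φ hφ).trans_eq ?_
    rw [Nat.card_sigma, Finset.sum_congr rfl fun W _ => hW W, Finset.sum_const, smul_eq_mul,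
      Finset.card_univ, Fintype.card_eq_nat_card, ← Nat.card_coe_set_eq]
  calc _ ≤ _ := hindep
    _ ≤ _ := Nat.mul_le_mul_right _ hspan
    _ = _ := by rw [mul_assoc, ← pow_add]

/-- A finite elementary abelian `p`-group of rank `n` has at least `p ^ (r * n) / p ^ (r * r + r)`
subgroups of order `p ^ r`. -/
theorem pow_le_ncard_addSubgroup_card_eq_mul (p : ℕ) [Fact p.Prime] (V : Type*) [AddCommGroup V]
    [Module (ZMod p) V] [Finite V] {r : ℕ} (hr : r ≤ Module.finrank (ZMod p) V) :
    p ^ (r * Module.finrank (ZMod p) V) ≤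
      {H : AddSubgroup V | Nat.card H = p ^ r}.ncard * p ^ (r * r + r) := by
  have hcount := pow_le_ncard_submodule_finrank_eq_mul hr
  rw [Nat.card_zmod] at hcount
  refine hcount.trans (Nat.mul_le_mul_right _ ?_)
  refine Set.ncard_le_ncard_of_injOn Submodule.toAddSubgroup (fun W hW => ?_)
    Submodule.toAddSubgroup_injective.injOn
  replace hW : Module.finrank (ZMod p) W = r := hW
  change Nat.card W = p ^ r
  rw [← FiniteField.pow_finrank_eq_natCard p W, hW]

/-- In a finite abelian group, the `m ^ k`-torsion has at most `|A[m]| ^ k` elements. -/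
theorem AddCommGroup.card_pow_torsion_le (A : Type*) [AddCommGroup A] [Finite A] (m k : ℕ) :
    Nat.card {a : A // m ^ k • a = 0} ≤ Nat.card {a : A // m • a = 0} ^ k := by
  classical
  have := Fintype.ofFinite A
  induction k with
  | zero =>
    have : Subsingleton {a : A // m ^ 0 • a = 0} :=
      ⟨fun a b => Subtype.ext (by simpa using a.2.trans b.2.symm)⟩
    simp only [pow_zero]
    exact Finite.card_le_one_iff_subsingleton.mpr this
  | succ k ih =>
    rw [pow_succ' (Nat.card _)]
    refine le_trans ?_ (Nat.mul_le_mul_left _ ih)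
    simp only [Nat.card_eq_fintype_card, Fintype.card_subtype]
    refine (Finset.card_le_mul_card_image (f := fun a : A => m • a) _ _ ?_).trans
      (Nat.mul_le_mul_left _ (Finset.card_le_card ?_))
    · intro b hb
      obtain ⟨x, -, rfl⟩ := Finset.mem_image.mp hb
      refine Finset.card_le_card_of_injOn (fun y => y - x) (fun y hy => ?_)
        (sub_left_injective.injOn)
      simp only [Finset.coe_filter, Finset.mem_filter, Finset.mem_univ, true_and,
        Set.mem_ofPred_eq] at hy ⊢
      rw [smul_sub, hy.2, sub_self]
    · intro b hb
      obtain ⟨x, hx, rfl⟩ := Finset.mem_image.mp hb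
      simpa [pow_succ, mul_smul] using hx

/-- lower bound from the Appendix. Let `p` be a prime, `α ≥ 2`,
`N ≥ 1`, and let `A` be a finite abelian `p`-group of order `p^{Nα}` whose exponent
divides `p^{α−1}`. For every `1 ≤ r ≤ N`, the number of subgroups of `A` of order `p^r`
is at least `p^{(α/(α−1))·Nr − 2r²}`. -/
theorem count_subgroups_small_exponent_lower
    (p : ℕ) [Fact p.Prime] (α N : ℕ) (hα : 2 ≤ α) (hN : 1 ≤ N)
    (A : Type) [AddCommGroup A] [Fintype A]
    (hcard : Nat.card A = p ^ (N * α))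
    (hexp : ∀ a : A, (p ^ (α - 1)) • a = 0)
    (r : ℕ) (hr1 : 1 ≤ r) (hrN : r ≤ N) :
    (p : ℝ) ^ (((α : ℝ) / ((α : ℝ) - 1)) * (N : ℝ) * (r : ℝ) - 2 * (r : ℝ) ^ 2) ≤
      ({H : AddSubgroup A | Nat.card H = p ^ r}.ncard : ℝ) := by
  have hp : 1 < p := (Fact.out : p.Prime).one_lt
  let V : AddSubgroup A := (nsmulAddMonoidHom p : A →+ A).ker
  let _ : Module (ZMod p) V := AddCommGroup.zmodModule fun x => Subtype.ext x.2
  set d := Module.finrank (ZMod p) V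
  have hV : Nat.card V = p ^ d := (FiniteField.pow_finrank_eq_natCard p V).symm
  have hdim : N * α ≤ d * (α - 1) := by
    have h := AddCommGroup.card_pow_torsion_le A p (α - 1)
    rw [Nat.card_congr (Equiv.subtypeUnivEquiv hexp), hcard,
      show Nat.card {a : A // p • a = 0} = p ^ d from hV, ← pow_mul] at h
    exact (Nat.pow_le_pow_iff_right hp).mp h
  have hrd : r ≤ d := by
    by_contra! h
    have : d * (α - 1) ≤ N * (α - 1) := Nat.mul_le_mul_right _ (by lia)
    have : N * (α - 1) < N * α := Nat.mul_lt_mul_of_pos_left (by lia) hN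
    lia
  have hcount := pow_le_ncard_addSubgroup_card_eq_mul p V hrd
  have hsub : {H : AddSubgroup V | Nat.card H = p ^ r}.ncard ≤
      {H : AddSubgroup A | Nat.card H = p ^ r}.ncard := by
    refine Set.ncard_le_ncard_of_injOn (AddSubgroup.map V.subtype) (fun H hH => ?_)
      (AddSubgroup.map_injective V.subtype_injective).injOn
    exact (AddSubgroup.card_map_of_injective V.subtype_injective).trans hH
  have hp0 : (0 : ℝ) < p := by exact_mod_cast (by lia : 0 < p)
  have hp1 : (1 : ℝ) ≤ p := by exact_mod_cast hp.le
  have hα1 : (0 : ℝ) < (α : ℝ) - 1 := by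
    have : (2 : ℝ) ≤ α := by exact_mod_cast hα
    linarith
  have hdimR : (α : ℝ) / ((α : ℝ) - 1) * N ≤ d := by
    have h : ((N * α : ℕ) : ℝ) ≤ ((d * (α - 1) : ℕ) : ℝ) := by exact_mod_cast hdim
    push_cast [Nat.cast_sub (by lia : 1 ≤ α)] at h
    rw [div_mul_eq_mul_div, div_le_iff₀ hα1]
    linarith
  have hr1R : (1 : ℝ) ≤ r := by exact_mod_cast hr1
  have hexponent : (α : ℝ) / ((α : ℝ) - 1) * N * r - 2 * (r : ℝ) ^ 2 ≤
      ((r * d : ℕ) : ℝ) - ((r * r + r : ℕ) : ℝ) := by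
    push_cast
    nlinarith [mul_le_mul_of_nonneg_right hdimR (by linarith : (0 : ℝ) ≤ r)]
  refine (Real.rpow_le_rpow_of_exponent_le hp1 hexponent).trans ?_
  rw [Real.rpow_sub hp0, Real.rpow_natCast, Real.rpow_natCast, div_le_iff₀ (by positivity)]
  exact_mod_cast hcount.trans (Nat.mul_le_mul_right _ hsub)
end

section
/- Let p be a prime and α, N ≥ 1. For every r with 1 ≤ r ≤ αN, the number of cosets of subgroups of (ℤ/p^αℤ)^N having cardinality exactly p^r is at most 2^{r−1}·p^{Nr + r² + αN − r}. -/
open scoped Pointwise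

/-- A subset of an (additively written) commutative group is a coset if it has the form
`g + Δ` for some subgroup `Δ` and group element `g`. -/
def IsAddCoset {X : Type} [AddCommGroup X] (S : Set X) : Prop :=
  ∃ (Δ : AddSubgroup X) (g : X), S = g +ᵥ (Δ : Set X)

/-- A quotient of a finite additive commutative group has at most as much `n`-torsion as the
group itself. -/
theorem AddSubgroup.card_ker_nsmul_quotient_le {G : Type*} [AddCommGroup G] [Finite G]
    (K : AddSubgroup G) (n : ℕ) :
    Nat.card (nsmulAddMonoidHom (α := G ⧸ K) n).ker ≤
      Nat.card (nsmulAddMonoidHom (α := G) n).ker := by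
  rw [← AddSubgroup.index_range, ← AddSubgroup.index_range,
    ← AddSubgroup.index_comap_of_surjective _ (QuotientAddGroup.mk'_surjective K)]
  refine Nat.le_of_dvd (Nat.pos_of_ne_zero AddSubgroup.index_ne_zero_of_finite)
    (AddSubgroup.index_dvd_of_le ?_)
  rintro _ ⟨x, rfl⟩
  exact ⟨(x : G ⧸ K), by simp⟩

/-- An additive subgroup of order `p ^ (r + 1)` contains one of order `p ^ r`. -/
theorem AddSubgroup.exists_le_card_eq_pow_prime {G : Type*} [AddCommGroup G] [Finite G]
    (p : ℕ) [Fact p.Prime] (r : ℕ) (H : AddSubgroup G) (hH : Nat.card H = p ^ (r + 1)) :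
    ∃ K ≤ H, Nat.card K = p ^ r := by
  obtain ⟨L, hL⟩ := Sylow.exists_subgroup_card_pow_prime (G := Multiplicative H) p (n := r)
    (by rw [Nat.card_congr Multiplicative.toAdd, hH]; exact pow_dvd_pow p r.le_succ)
  refine ⟨(AddSubgroup.toSubgroup.symm L).map H.subtype, AddSubgroup.map_subtype_le _, ?_⟩
  rw [← hL]
  exact AddSubgroup.card_map_of_injective H.subtype_injective

/-- If `K < H` has prime index in `H`, then `K` and any further element of `H` generate `H`. -/
theorem AddSubgroup.sup_zmultiples_eq_of_card {G : Type*} [AddCommGroup G] [Finite G]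
    {p r : ℕ} (hp : p.Prime) {H K : AddSubgroup G} (hK : Nat.card K = p ^ r)
    (hH : Nat.card H = p ^ (r + 1)) (hKH : K ≤ H) {x : G} (hx : x ∈ H) (hxK : x ∉ K) :
    K ⊔ AddSubgroup.zmultiples x = H := by
  have hle : K ⊔ AddSubgroup.zmultiples x ≤ H :=
    sup_le hKH (AddSubgroup.zmultiples_le_of_mem hx)
  obtain ⟨m, hm, hcard⟩ :=
    (Nat.dvd_prime_pow hp).1 (hH ▸ AddSubgroup.card_dvd_of_le hle)
  refine AddSubgroup.eq_of_le_of_card_ge hle ?_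
  rw [hH, hcard]
  refine Nat.pow_le_pow_right hp.pos ?_
  by_contra! hlt
  refine hxK ?_
  rw [AddSubgroup.eq_of_le_of_card_ge (le_sup_left : K ≤ K ⊔ AddSubgroup.zmultiples x)
    (by rw [hK, hcard]; exact Nat.pow_le_pow_right hp.pos (by omega))]
  exact (le_sup_right : _ ≤ K ⊔ AddSubgroup.zmultiples x) (AddSubgroup.mem_zmultiples x)

/-- A finite additive commutative group with `t` elements killed by `p` has at most `t ^ r`
subgroups of order `p ^ r`. -/
theorem AddSubgroup.card_subgroups_card_eq_pow_le {G : Type*} [AddCommGroup G] [Finite G]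
    (p : ℕ) [hp : Fact p.Prime] (r : ℕ) :
    Nat.card {H : AddSubgroup G // Nat.card H = p ^ r} ≤
      Nat.card (nsmulAddMonoidHom (α := G) p).ker ^ r := by
  induction r with
  | zero => simp
  | succ r ih =>
    have key (H : {H : AddSubgroup G // Nat.card H = p ^ (r + 1)}) :
        ∃ y : Σ K : {K : AddSubgroup G // Nat.card K = p ^ r},
          (nsmulAddMonoidHom (α := G ⧸ K.1) p).ker,
          (AddSubgroup.zmultiples y.2.1).comap (QuotientAddGroup.mk' y.1.1) = H.1 := by
      obtain ⟨H, hH⟩ := H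
      obtain ⟨K, hKH, hK⟩ := AddSubgroup.exists_le_card_eq_pow_prime p r H hH
      have hlt : Nat.card K < Nat.card H := by
        rw [hK, hH]; exact Nat.pow_lt_pow_right hp.out.one_lt r.lt_succ_self
      obtain ⟨x, hx, hxK⟩ : ∃ x ∈ H, x ∉ K := by
        by_contra! h
        exact hlt.not_ge (AddSubgroup.card_le_of_le h)
      have hindex : (K.addSubgroupOf H).index = p := by
        have := (K.addSubgroupOf H).card_mul_index
        rw [Nat.card_congr (AddSubgroup.addSubgroupOfEquivOfLe hKH).toEquiv, hK, hH,
          pow_succ] at this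
        exact Nat.eq_of_mul_eq_mul_left (pow_pos hp.out.pos r) this
      have hpx : p • x ∈ K := by
        have := (K.addSubgroupOf H).nsmul_index_mem ⟨x, hx⟩
        rw [hindex] at this
        exact this
      refine ⟨⟨⟨K, hK⟩, ⟨QuotientAddGroup.mk' K x, ?_⟩⟩, ?_⟩
      · rw [AddMonoidHom.mem_ker, nsmulAddMonoidHom_apply, ← map_nsmul]
        exact (QuotientAddGroup.eq_zero_iff _).2 hpx
      · rw [← AddMonoidHom.map_zmultiples, AddSubgroup.comap_map_eq, QuotientAddGroup.ker_mk',
          sup_comm]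
        exact AddSubgroup.sup_zmultiples_eq_of_card hp.out hK hH hKH hx hxK
    choose f hf' using key
    have hf : Function.Injective f := fun H₁ H₂ h ↦
      Subtype.ext (by rw [← hf' H₁, ← hf' H₂, h])
    refine (Nat.card_le_card_of_injective f hf).trans ?_
    have := Fintype.ofFinite {K : AddSubgroup G // Nat.card K = p ^ r}
    rw [Nat.card_sigma, pow_succ]
    refine (Finset.sum_le_card_nsmul _ _ _
      fun K _ ↦ AddSubgroup.card_ker_nsmul_quotient_le K.1 p).trans ?_
    rw [smul_eq_mul, Finset.card_univ, ← Nat.card_eq_fintype_card]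
    exact Nat.mul_le_mul_right _ ih

/-- At most `n ^ N` elements of `(ℤ/mℤ)^N` are killed by `n`. -/
theorem ZMod.card_ker_nsmul_pi_le (m N n : ℕ) [NeZero m] (hn : 0 < n) :
    Nat.card (nsmulAddMonoidHom (α := Fin N → ZMod m) n).ker ≤ n ^ N := by
  have hcard : Nat.card {x : ZMod m // n • x = 0} ≤ n := by
    rw [Nat.card_eq_fintype_card, Fintype.card_subtype]
    exact IsAddCyclic.card_nsmul_eq_zero_le hn
  let f : (nsmulAddMonoidHom (α := Fin N → ZMod m) n).ker → Fin N → {x : ZMod m // n • x = 0} :=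
    fun x i ↦ ⟨x.1 i, congrFun x.2 i⟩
  have hf : Function.Injective f := fun x y h ↦
    Subtype.ext (funext fun i ↦ congrArg Subtype.val (congrFun h i))
  refine (Nat.card_le_card_of_injective f hf).trans ?_
  rw [Nat.card_fun, Nat.card_fin]
  exact Nat.pow_le_pow_left hcard N

/-- The number of cosets of cardinality `n` is at most the number of subgroups of order `n`
times their common index. -/
theorem ncard_isAddCoset_le {G : Type} [AddCommGroup G] [Finite G] (n k : ℕ) (hn : 0 < n)
    (hG : Nat.card G = n * k) :
    {S : Set G | IsAddCoset S ∧ S.ncard = n}.ncard ≤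
      Nat.card {H : AddSubgroup G // Nat.card H = n} * k := by
  let f : (Σ K : {K : AddSubgroup G // Nat.card K = n}, G ⧸ K.1) → Set G :=
    fun y ↦ QuotientAddGroup.mk ⁻¹' {y.2}
  have hsub : {S : Set G | IsAddCoset S ∧ S.ncard = n} ⊆ Set.range f := by
    rintro _ ⟨⟨K, g, rfl⟩, hS⟩
    have hK : Nat.card K = n := by
      rw [← hS, Set.ncard_vadd_set]
      rfl
    refine ⟨⟨⟨K, hK⟩, (g : G ⧸ K)⟩, ?_⟩
    ext x
    rw [Set.mem_vadd_set_iff_neg_vadd_mem]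
    exact eq_comm.trans QuotientAddGroup.eq
  refine (Set.ncard_le_ncard hsub (Set.toFinite _)).trans ?_
  refine (Finite.card_range_le f).trans ?_
  have := Fintype.ofFinite {K : AddSubgroup G // Nat.card K = n}
  have hindex (K : {K : AddSubgroup G // Nat.card K = n}) : Nat.card (G ⧸ K.1) = k := by
    have := K.1.card_mul_index
    rw [K.2, hG] at this
    exact Nat.eq_of_mul_eq_mul_left hn this
  simp [Nat.card_sigma, hindex]

/-- upper bound of Lemma 5. Let `p` be a prime and `α, N ≥ 1`.
For every `1 ≤ r ≤ αN`, the number of cosets of subgroups of `(ℤ/p^αℤ)^N` of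
cardinality exactly `p^r` is at most `2^{r−1}·p^{Nr + r² + αN − r}`. -/
theorem count_cosets_homocyclic_upper
    (p : ℕ) [Fact p.Prime] (α N r : ℕ) (hα : 1 ≤ α) (hN : 1 ≤ N)
    (hr1 : 1 ≤ r) (hr : r ≤ α * N) :
    {S : Set (Fin N → ZMod (p ^ α)) | IsAddCoset S ∧ S.ncard = p ^ r}.ncard ≤
      2 ^ (r - 1) * p ^ (N * r + r ^ 2 + α * N - r) := by
  have hp : 0 < p := (Fact.out : p.Prime).pos
  have hG : Nat.card (Fin N → ZMod (p ^ α)) = p ^ r * p ^ (α * N - r) := by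
    rw [Nat.card_fun, Nat.card_zmod, Nat.card_fin, ← pow_mul, ← pow_add, Nat.add_sub_cancel' hr]
  have : NeZero (p ^ α) := ⟨(pow_pos hp α).ne'⟩
  calc _ ≤ _ := ncard_isAddCoset_le _ _ (pow_pos hp r) hG
    _ ≤ (p ^ N) ^ r * p ^ (α * N - r) := by
      gcongr
      exact (AddSubgroup.card_subgroups_card_eq_pow_le p r).trans
        (Nat.pow_le_pow_left (ZMod.card_ker_nsmul_pi_le _ _ _ hp) r)
    _ = 1 * p ^ (N * r + (α * N - r)) := by rw [← pow_mul, ← pow_add, one_mul]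
    _ ≤ _ := Nat.mul_le_mul Nat.one_le_two_pow (Nat.pow_le_pow_right hp (by omega))
end

section
/- Let p be a prime, α ≥ 2 and N ≥ 1. Let A be a finite abelian p-group of order p^{Nα} whose exponent divides p^{α−1}. Then for every r with 1 ≤ r ≤ N, the number of cosets of subgroups of A having cardinality exactly p^r is at least p^{(α/(α−1))·Nr − 2r² + αN − r}. -/
open scoped Pointwise

/-- A finite abelian group killed by `n ^ k` has at most `|A[n]| ^ k` elements. -/
theorem card_le_card_ker_nsmul_pow (n k : ℕ) (A : Type*) [AddCommGroup A] [Finite A]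
    (h : ∀ a : A, n ^ k • a = 0) :
    Nat.card A ≤ Nat.card (nsmulAddMonoidHom n : A →+ A).ker ^ k := by
  induction k generalizing A with
  | zero =>
    have : Subsingleton A := ⟨fun a b => by
      rw [← one_nsmul a, ← one_nsmul b, ← pow_zero n, h, h]⟩
    simp
  | succ k ih =>
    set f : A →+ A := nsmulAddMonoidHom n
    have hR : ∀ a : f.range, n ^ k • a = 0 := by
      rintro ⟨_, b, rfl⟩
      apply Subtype.ext
      simpa [f, ← mul_nsmul', ← pow_succ] using h b
    have hker : Nat.card (nsmulAddMonoidHom n : f.range →+ f.range).ker ≤ Nat.card f.ker := by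
      refine Nat.card_le_card_of_injective
        (fun x => (⟨x.1.1, congrArg Subtype.val (AddMonoidHom.mem_ker.mp x.2)⟩ : f.ker)) ?_
      intro x y hxy
      exact Subtype.ext (Subtype.ext (Subtype.mk.inj hxy))
    calc Nat.card A = Nat.card f.ker * Nat.card f.range := by
          rw [← AddSubgroup.index_ker, AddSubgroup.card_mul_index]
      _ ≤ Nat.card f.ker * Nat.card f.ker ^ k :=
          Nat.mul_le_mul_left _ ((ih _ hR).trans (Nat.pow_le_pow_left hker k))
      _ = Nat.card f.ker ^ (k + 1) := (pow_succ' _ _).symm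

theorem pow_le_card_linearIndependent (K V : Type*) [Field K] [Fintype K] [AddCommGroup V]
    [Module K V] [Finite V] {r : ℕ} (hr : r ≤ Module.finrank K V) :
    (Fintype.card K ^ (Module.finrank K V - 1)) ^ r ≤
      Nat.card {s : Fin r → V // LinearIndependent K s} := by
  have := Fintype.ofFinite V
  rw [card_linearIndependent hr]
  calc (Fintype.card K ^ (Module.finrank K V - 1)) ^ r
      = ∏ _i : Fin r, Fintype.card K ^ (Module.finrank K V - 1) := by simp
    _ ≤ _ := by
      refine Finset.prod_le_prod' fun i _ => ?_
      have hK : 2 ≤ Fintype.card K := Fintype.one_lt_card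
      have hi := i.2
      have h1 : Fintype.card K ^ i.val ≤ Fintype.card K ^ (Module.finrank K V - 1) :=
        Nat.pow_le_pow_right (by omega) (by omega)
      have h2 : Fintype.card K ^ Module.finrank K V =
          Fintype.card K ^ (Module.finrank K V - 1) * Fintype.card K := by
        rw [← pow_succ, Nat.sub_add_cancel (by omega)]
      have h3 := Nat.mul_le_mul_left (Fintype.card K ^ (Module.finrank K V - 1)) hK
      omega

/-- Affinely independent tuples in translates of an elementary abelian subgroup `V` are counted
by the cosets they span. -/
theorem card_mul_card_linearIndependent_le (p : ℕ) [Fact p.Prime] (A : Type) [AddCommGroup A]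
    [Finite A] (V : AddSubgroup A) [Module (ZMod p) V] (r : ℕ) :
    Nat.card A * Nat.card {s : Fin r → V // LinearIndependent (ZMod p) s} ≤
      (p ^ r * (p ^ r) ^ r) * {S : Set A | IsAddCoset S ∧ S.ncard = p ^ r}.ncard := by
  classical
  have := Fintype.ofFinite A
  let span (s : Fin r → V) : AddSubgroup A :=
    (Submodule.span (ZMod p) (Set.range s)).toAddSubgroup.map V.subtype
  have hspan (s : Fin r → V) (hs : LinearIndependent (ZMod p) s) :
      (span s : Set A).ncard = p ^ r := by
    rw [AddSubgroup.coe_map, Set.ncard_image_of_injective _ V.subtype_injective,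
      ← Nat.card_coe_set_eq]
    change Nat.card (Submodule.span (ZMod p) (Set.range s)) = _
    rw [Module.natCard_eq_pow_finrank (K := ZMod p), finrank_span_eq_card hs]
    simp
  let f (x : A × {s : Fin r → V // LinearIndependent (ZMod p) s}) : Set A :=
    x.1 +ᵥ (span x.2.1 : Set A)
  have := Fintype.ofFinite {s : Fin r → V // LinearIndependent (ZMod p) s}
  have key := Finset.card_le_mul_card_image_of_maps_to (f := f) (s := Finset.univ)
    (t := {S : Set A | IsAddCoset S ∧ S.ncard = p ^ r}.toFinset) (fun x _ => by
      simp only [Set.mem_toFinset, Set.mem_ofPred_eq]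
      exact ⟨⟨_, _, rfl⟩, by rw [Set.ncard_vadd_set, hspan _ x.2.2]⟩)
    (p ^ r * (p ^ r) ^ r) ?_
  · rwa [Finset.card_univ, ← Nat.card_eq_fintype_card, Nat.card_prod,
      ← Set.ncard_eq_toFinset_card'] at key
  intro S hS
  simp only [Set.mem_toFinset, Set.mem_ofPred_eq] at hS
  have hcard : Nat.card (S × (Fin r → S)) = p ^ r * (p ^ r) ^ r := by
    rw [Nat.card_prod, Nat.card_fun, Nat.card_coe_set_eq, hS.2]
    simp
  rw [← hcard, ← Fintype.card_coe, ← Nat.card_eq_fintype_card]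
  have hf (x) (hx : f x = S) : x.1 ∈ S ∧ ∀ i, x.1 + (x.2.1 i : A) ∈ S := by
    subst hx
    refine ⟨⟨0, (span x.2.1).zero_mem, add_zero _⟩, fun i => ⟨x.2.1 i, ?_, rfl⟩⟩
    exact ⟨x.2.1 i, Submodule.subset_span (Set.mem_range_self i), rfl⟩
  refine Nat.card_le_card_of_injective (fun x =>
    (⟨x.1.1, (hf x.1 (Finset.mem_filter.mp x.2).2).1⟩,
      fun i => ⟨x.1.1 + x.1.2.1 i, (hf x.1 (Finset.mem_filter.mp x.2).2).2 i⟩)) ?_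
  rintro ⟨⟨a, s, hs⟩, hx⟩ ⟨⟨b, t, ht⟩, hy⟩ h
  simp only [Prod.mk.injEq, Subtype.mk.injEq, funext_iff] at h
  obtain ⟨rfl, h⟩ := h
  obtain rfl : s = t := funext fun i => Subtype.ext (add_left_cancel (h i))
  rfl

/-- lower bound of Lemma 5. Let `p` be a prime, `α ≥ 2`, `N ≥ 1`,
and let `A` be a finite abelian `p`-group of order `p^{Nα}` whose exponent divides
`p^{α−1}`. For every `1 ≤ r ≤ N`, the number of cosets of subgroups of `A` of
cardinality exactly `p^r` is at least `p^{(α/(α−1))·Nr − 2r² + αN − r}`. -/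
theorem count_cosets_small_exponent_lower
    (p : ℕ) [Fact p.Prime] (α N : ℕ) (hα : 2 ≤ α) (hN : 1 ≤ N)
    (A : Type) [AddCommGroup A] [Fintype A]
    (hcard : Nat.card A = p ^ (N * α))
    (hexp : ∀ a : A, (p ^ (α - 1)) • a = 0)
    (r : ℕ) (hr1 : 1 ≤ r) (hrN : r ≤ N) :
    (p : ℝ) ^ (((α : ℝ) / ((α : ℝ) - 1)) * (N : ℝ) * (r : ℝ) - 2 * (r : ℝ) ^ 2 +
        (α : ℝ) * (N : ℝ) - (r : ℝ)) ≤
      ({S : Set A | IsAddCoset S ∧ S.ncard = p ^ r}.ncard : ℝ) := by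
  have hp : p.Prime := Fact.out
  let V := (nsmulAddMonoidHom p : A →+ A).ker
  let _ : Module (ZMod p) V := AddCommGroup.zmodModule fun x => Subtype.ext x.2
  set d := Module.finrank (ZMod p) V
  have hV : Nat.card V = p ^ d := (FiniteField.pow_finrank_eq_natCard p V).symm
  have hd : N * α ≤ d * (α - 1) := by
    have h := card_le_card_ker_nsmul_pow p (α - 1) A hexp
    change _ ≤ Nat.card V ^ (α - 1) at h
    rwa [hcard, hV, ← pow_mul, Nat.pow_le_pow_iff_right hp.one_lt] at h
  have hNd : N ≤ d := by
    refine Nat.le_of_mul_le_mul_right (c := α - 1) ?_ (by omega)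
    exact (Nat.mul_le_mul_left N (Nat.sub_le α 1)).trans hd
  have hli := pow_le_card_linearIndependent (ZMod p) V (hrN.trans hNd)
  rw [ZMod.card] at hli
  have hmain := (Nat.mul_le_mul_left (Nat.card A) hli).trans
    (card_mul_card_linearIndependent_le p A V r)
  set C := {S : Set A | IsAddCoset S ∧ S.ncard = p ^ r}.ncard
  rw [hcard] at hmain
  change p ^ (N * α) * (p ^ (d - 1)) ^ r ≤ _ at hmain
  rw [← pow_mul, ← pow_mul, ← pow_add, ← pow_add] at hmain
  have hp0 : (0 : ℝ) < p := by exact_mod_cast hp.pos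
  have hp1 : (1 : ℝ) ≤ p := by exact_mod_cast hp.one_lt.le
  have hmainR : (p : ℝ) ^ (N * α + (d - 1) * r) ≤ (p : ℝ) ^ (r + r * r) * C := by
    exact_mod_cast hmain
  refine le_of_mul_le_mul_left (le_trans ?_ hmainR) (pow_pos hp0 (r + r * r))
  rw [← Real.rpow_natCast (p : ℝ) (r + r * r), ← Real.rpow_natCast (p : ℝ) (N * α + (d - 1) * r),
    ← Real.rpow_add hp0]
  refine Real.rpow_le_rpow_of_exponent_le hp1 ?_
  have hα' : (0 : ℝ) < (α : ℝ) - 1 := by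
    have : (2 : ℝ) ≤ α := by exact_mod_cast hα
    linarith
  have hdR : (α : ℝ) / ((α : ℝ) - 1) * N ≤ d := by
    rw [div_mul_eq_mul_div, div_le_iff₀ hα']
    have : (N * α : ℝ) ≤ d * ((α - 1 : ℕ) : ℝ) := by exact_mod_cast hd
    rw [Nat.cast_sub (by omega), Nat.cast_one] at this
    linarith
  have hr : (1 : ℝ) ≤ r := by exact_mod_cast hr1
  have hdr := mul_le_mul_of_nonneg_right hdR (zero_le_one.trans hr)
  push_cast [Nat.cast_sub (show 1 ≤ d by omega)]
  nlinarith
end
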